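/- Theorem 1 (almost-sure version). Let (Ω, 𝓕, P) be a probability space, S a type, A a finite nonempty type of actions containing a distinguished control action 0, and τ : S → A → ℝ a function with τ s 0 = 0 for all s and sup_{s ∈ S, a ∈ A} |τ s a| ≤ B for some finite B. Let (K_N) be natural numbers with 1 ≤ K_N ≤ N and K_N / N → c for some c with 0 < c ≤ 1. For each N, let s^N : Ω → (Fin N → S) be a random state vector and τ̂_N : Ω → (S → A → ℝ) a random estimated function such that ε_N(ω) := sup_{s ∈ S, a ∈ A} |τ s a − τ̂_N(ω) s a| → 0 as N → ∞ for P-almost every ω. For each N and ω, let π_N(ω) be an induced top-K_N policy for τ̂_N(ω) at s^N(ω) and π*_N(ω) an induced top-K_N policy for τ at s^N(ω), and assume the functions ω ↦ (1/K_N) ∑_{i} τ (s^N(ω) i) (π_N(ω) i) and ω ↦ (1/K_N) ∑_{i} τ (s^N(ω) i) (π*_N(ω) i) are measurable. Then E[(1/K_N) ∑_{i} τ (s^N i) (π_N i)] − E[(1/K_N) ∑_{i} τ (s^N i) (π*_N i)] → 0 as N → ∞; i.e. ATT_{K_N}(π_N) − ATT_{K_N}(π*_N) → 0. -/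

import Mathlib

open Filter MeasureTheory

/-- `π` is an induced top-`K` policy for `f` at state vector `s`. -/
def IsTopKPolicy {S A : Type*} [Fintype A] [Nonempty A] [Zero A] {N : ℕ}
    (f : S → A → ℝ) (s : Fin N → S) (K : ℕ) (π : Fin N → A) : Prop :=
  ∃ T : Finset (Fin N), T.card = K ∧
    (∀ i ∈ T, ∀ j ∉ T,
      Finset.univ.sup' Finset.univ_nonempty (f (s j)) ≤
        Finset.univ.sup' Finset.univ_nonempty (f (s i))) ∧
    (∀ i ∈ T, f (s i) (π i) = Finset.univ.sup' Finset.univ_nonempty (f (s i))) ∧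
    (∀ i ∉ T, π i = 0)

theorem topK_sum_le {N : ℕ} (b : Fin N → ℝ) (T U : Finset (Fin N)) (hc : U.card = T.card)
    (hT : ∀ i ∈ T, ∀ j ∉ T, b j ≤ b i) : ∑ i ∈ U, b i ≤ ∑ i ∈ T, b i := by
  rcases T.eq_empty_or_nonempty with h | h
  · subst h
    have : U = ∅ := Finset.card_eq_zero.mp (by simpa using hc)
    simp [this]
  · obtain ⟨k, hk, hmin⟩ := Finset.exists_min_image T b h
    have e := Finset.sum_sdiff_sub_sum_sdiff (s₁ := U) (s₂ := T) (f := b)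
    have h1 : ∑ i ∈ U \ T, b i ≤ (U \ T).card • b k :=
      Finset.sum_le_card_nsmul _ _ _ fun i hi => hT k hk i (Finset.mem_sdiff.mp hi).2
    have h2 : (T \ U).card • b k ≤ ∑ i ∈ T \ U, b i :=
      Finset.card_nsmul_le_sum _ _ _ fun i hi => hmin i (Finset.mem_sdiff.mp hi).1
    rw [Finset.card_sdiff_comm hc] at h1
    linarith

theorem topK_policy_sum_le {S A : Type*} [Fintype A] [Nonempty A] {N : ℕ}
    (f : S → A → ℝ) (s : Fin N → S) (π ρ : Fin N → A) (T U : Finset (Fin N))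
    (hc : U.card = T.card)
    (hT : ∀ i ∈ T, ∀ j ∉ T,
      Finset.univ.sup' Finset.univ_nonempty (f (s j)) ≤
        Finset.univ.sup' Finset.univ_nonempty (f (s i)))
    (hm : ∀ i ∈ T, f (s i) (π i) = Finset.univ.sup' Finset.univ_nonempty (f (s i))) :
    ∑ i ∈ U, f (s i) (ρ i) ≤ ∑ i ∈ T, f (s i) (π i) := by
  rw [Finset.sum_congr rfl hm]
  refine le_trans (Finset.sum_le_sum fun i _ => ?_)
    (topK_sum_le (fun i => Finset.univ.sup' Finset.univ_nonempty (f (s i))) T U hc hT)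
  exact Finset.le_sup' (f (s i)) (Finset.mem_univ (ρ i))

theorem topK_sum_eq {S A : Type*} [Zero A] {N : ℕ}
    (τ : S → A → ℝ) (hτ0 : ∀ x : S, τ x 0 = 0) (s : Fin N → S) (π : Fin N → A)
    (T : Finset (Fin N)) (h : ∀ i ∉ T, π i = 0) :
    ∑ i, τ (s i) (π i) = ∑ i ∈ T, τ (s i) (π i) := by
  symm
  apply Finset.sum_subset (Finset.subset_univ _)
  intro i _ hi
  rw [h i hi, hτ0]

theorem topK_bound {S A : Type*} [Fintype A] [Nonempty A] [Zero A] {N K : ℕ} (hK : 1 ≤ K)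
    (τ f : S → A → ℝ) (hτ0 : ∀ x : S, τ x 0 = 0) (B : ℝ) (hB : ∀ (x : S) (a : A), |τ x a| ≤ B)
    (s : Fin N → S) (π : Fin N → A) (h : IsTopKPolicy f s K π) :
    ‖(1 / (K : ℝ)) * ∑ i, τ (s i) (π i)‖ ≤ B := by
  obtain ⟨T, hc, -, -, h0⟩ := h
  have hK' : (0 : ℝ) < K := by exact_mod_cast hK
  rw [topK_sum_eq τ hτ0 s π T h0, Real.norm_eq_abs, abs_mul, abs_of_pos (by positivity),
    one_div, inv_mul_le_iff₀ hK']
  refine (Finset.abs_sum_le_sum_abs _ _).trans ?_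
  refine (Finset.sum_le_card_nsmul _ _ B fun i _ => hB _ _).trans ?_
  rw [hc, nsmul_eq_mul]

theorem topK_regret {S A : Type*} [Fintype A] [Nonempty A] [Zero A] {N K : ℕ} (hK : 1 ≤ K)
    (τ f : S → A → ℝ) (hτ0 : ∀ x : S, τ x 0 = 0) (e : ℝ)
    (he : ∀ (x : S) (a : A), |τ x a - f x a| ≤ e)
    (s : Fin N → S) (π ρ : Fin N → A) (h : IsTopKPolicy f s K π) (h' : IsTopKPolicy τ s K ρ) :
    |(1 / (K : ℝ)) * ∑ i, τ (s i) (π i) - (1 / (K : ℝ)) * ∑ i, τ (s i) (ρ i)| ≤ 2 * e := by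
  obtain ⟨T, hc, hT, hm, h0⟩ := h
  obtain ⟨U, hc', hU, hm', h0'⟩ := h'
  have hK' : (0 : ℝ) < K := by exact_mod_cast hK
  rw [topK_sum_eq τ hτ0 s π T h0, topK_sum_eq τ hτ0 s ρ U h0', ← mul_sub, abs_mul,
    abs_of_pos (by positivity), one_div, inv_mul_le_iff₀ hK']
  have h1 := topK_policy_sum_le τ s ρ π U T (hc.trans hc'.symm) hU hm'
  have h2 := topK_policy_sum_le f s π ρ T U (hc'.trans hc.symm) hT hm
  have h3 : ∑ i ∈ T, (f (s i) (π i) - τ (s i) (π i)) ≤ K * e := by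
    rw [← hc, ← nsmul_eq_mul]
    refine Finset.sum_le_card_nsmul _ _ _ fun i _ => ?_
    have := abs_le.mp (he (s i) (π i))
    linarith
  have h4 : ∑ i ∈ U, (τ (s i) (ρ i) - f (s i) (ρ i)) ≤ K * e := by
    rw [← hc', ← nsmul_eq_mul]
    refine Finset.sum_le_card_nsmul _ _ _ fun i _ => ?_
    have := abs_le.mp (he (s i) (ρ i))
    linarith
  rw [Finset.sum_sub_distrib] at h3 h4
  rw [abs_of_nonpos (by linarith)]
  linarith

/-- Theorem 1 (almost-sure version): if the treatment effects are uniformly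
bounded, the uniform estimation error `ε N` tends to zero almost surely, and
`K N / N → c ∈ (0, 1]`, then `ATT_{K N}(π N) - ATT_{K N}(π* N) → 0`, where
`π N` are the top-`K N` policies induced by the random estimates `τ̂ N` and
`π* N` are the oracle top-`K N` policies induced by `τ`. -/
theorem topK_policy_ATT_regret_tendsto_zero_ae
    {Ω : Type*} [MeasurableSpace Ω] (P : Measure Ω) [IsProbabilityMeasure P]
    {S A : Type*} [Fintype A] [Nonempty A] [Zero A]
    (τ : S → A → ℝ) (hτ0 : ∀ x : S, τ x 0 = 0)
    (B : ℝ) (hB : ∀ (x : S) (a : A), |τ x a| ≤ B)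
    (K : ℕ → ℕ) (hK1 : ∀ N, 1 ≤ N → 1 ≤ K N) (hKN : ∀ N, 1 ≤ N → K N ≤ N)
    (c : ℝ) (hc0 : 0 < c) (hc1 : c ≤ 1)
    (hKlim : Tendsto (fun N => (K N : ℝ) / (N : ℝ)) atTop (nhds c))
    (s : (N : ℕ) → Ω → Fin N → S)
    (τhat : ℕ → Ω → S → A → ℝ)
    (ε : ℕ → Ω → ℝ)
    (hεsup : ∀ N ω (x : S) (a : A), |τ x a - τhat N ω x a| ≤ ε N ω)
    (hεae : ∀ᵐ ω ∂P, Tendsto (fun N => ε N ω) atTop (nhds 0))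
    (π : (N : ℕ) → Ω → Fin N → A)
    (hπ : ∀ N, 1 ≤ N → ∀ ω, IsTopKPolicy (τhat N ω) (s N ω) (K N) (π N ω))
    (πstar : (N : ℕ) → Ω → Fin N → A)
    (hπstar : ∀ N, 1 ≤ N → ∀ ω, IsTopKPolicy τ (s N ω) (K N) (πstar N ω))
    (hmeas : ∀ N, Measurable
      (fun ω => (1 / (K N : ℝ)) * ∑ i, τ (s N ω i) (π N ω i)))
    (hmeas_star : ∀ N, Measurable
      (fun ω => (1 / (K N : ℝ)) * ∑ i, τ (s N ω i) (πstar N ω i))) :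
    Tendsto
      (fun N =>
        (∫ ω, (1 / (K N : ℝ)) * ∑ i, τ (s N ω i) (π N ω i) ∂P) -
        (∫ ω, (1 / (K N : ℝ)) * ∑ i, τ (s N ω i) (πstar N ω i) ∂P))
      atTop (nhds 0) := by
  have hb : ∀ N, 1 ≤ N → ∀ ω, ‖(1 / (K N : ℝ)) * ∑ i, τ (s N ω i) (π N ω i)‖ ≤ B :=
    fun N hN ω => topK_bound (hK1 N hN) τ _ hτ0 B hB _ _ (hπ N hN ω)
  have hb' : ∀ N, 1 ≤ N → ∀ ω, ‖(1 / (K N : ℝ)) * ∑ i, τ (s N ω i) (πstar N ω i)‖ ≤ B :=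
    fun N hN ω => topK_bound (hK1 N hN) τ _ hτ0 B hB _ _ (hπstar N hN ω)
  have key : Tendsto (fun N => ∫ ω, ((1 / (K N : ℝ)) * ∑ i, τ (s N ω i) (π N ω i) -
      (1 / (K N : ℝ)) * ∑ i, τ (s N ω i) (πstar N ω i)) ∂P) atTop (nhds (∫ _ω, (0 : ℝ) ∂P)) := by
    refine tendsto_integral_filter_of_dominated_convergence (fun _ => B + B) ?_ ?_ ?_ ?_
    · exact Eventually.of_forall fun N => ((hmeas N).sub (hmeas_star N)).aestronglyMeasurable
    · filter_upwards [eventually_ge_atTop 1] with N hN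
      exact Eventually.of_forall fun ω =>
        (norm_sub_le _ _).trans (add_le_add (hb N hN ω) (hb' N hN ω))
    · exact integrable_const _
    · filter_upwards [hεae] with ω hω
      refine squeeze_zero_norm' (a := fun N => 2 * ε N ω) ?_ (by simpa using hω.const_mul 2)
      filter_upwards [eventually_ge_atTop 1] with N hN
      exact topK_regret (hK1 N hN) τ _ hτ0 _ (hεsup N ω) _ _ _ (hπ N hN ω) (hπstar N hN ω)
  rw [integral_zero] at key
  refine key.congr' ?_
  filter_upwards [eventually_ge_atTop 1] with N hN
  exact integral_sub
    (Integrable.of_bound (hmeas N).aestronglyMeasurable B (Eventually.of_forall (hb N hN)))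
    (Integrable.of_bound (hmeas_star N).aestronglyMeasurable B (Eventually.of_forall (hb' N hN)))
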